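/- arXiv:2304.12100 — 5 statements merged into one kernel-verified Lean document; each statement's English description precedes it below -/
import Mathlib

section
/- Let t and t₀ be positive integers with t₀ < t, and let x, y be integers with 0 ≤ x, y < 2^t. If d_t(x, y) < 2^{t − t₀}, then d_{t₀}(⌊x / 2^{t − t₀}⌋, ⌊y / 2^{t − t₀}⌋) ≤ 1. -/
/-- `dDist t x y = min(|x - y|, 2^t - |x - y|)`. -/
def dDist (t : ℕ) (x y : ℤ) : ℤ := min |x - y| (2 ^ t - |x - y|)

theorem stmt_2 (t t₀ : ℕ) (ht₀ : 0 < t₀) (ht : t₀ < t) (x y : ℤ)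
    (hx : 0 ≤ x) (hx' : x < 2 ^ t) (hy : 0 ≤ y) (hy' : y < 2 ^ t)
    (hd : dDist t x y < 2 ^ (t - t₀)) :
    dDist t₀ (x / 2 ^ (t - t₀)) (y / 2 ^ (t - t₀)) ≤ 1 := by
  unfold dDist at *
  obtain ⟨k, rfl⟩ := Nat.exists_eq_add_of_lt ht
  have e : t₀ + k + 1 - t₀ = k + 1 := by omega
  have e2 : (2 : ℤ) ^ (t₀ + k + 1) = 2 ^ (k + 1) * 2 ^ t₀ := by ring
  rw [e] at hd ⊢
  rw [e2] at hd
  have hM : (0 : ℤ) < 2 ^ (k + 1) := by positivity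
  generalize (2 : ℤ) ^ (k + 1) = M at *
  generalize (2 : ℤ) ^ t₀ = N at *
  have a1 := Int.mul_ediv_add_emod x M
  have a2 := Int.emod_nonneg x hM.ne'
  have a3 := Int.emod_lt_of_pos x hM
  have b1 := Int.mul_ediv_add_emod y M
  have b2 := Int.emod_nonneg y hM.ne'
  have b3 := Int.emod_lt_of_pos y hM
  generalize x / M = a at *
  generalize y / M = b at *
  have key : ∀ u v : ℤ, M * u < M * v → u < v := fun u v h => lt_of_mul_lt_mul_left h hM.le
  rcases min_lt_iff.1 hd with h | h
  · refine (min_le_left _ _).trans ?_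
    obtain ⟨h1, h2⟩ := abs_lt.1 h
    have c1 := key (a - b) 2 (by linarith)
    have c2 := key (b - a) 2 (by linarith)
    rw [abs_le]
    constructor <;> omega
  · refine (min_le_right _ _).trans ?_
    have g1 := le_abs_self (a - b)
    have g2 := neg_le_abs (a - b)
    rcases abs_cases (x - y) with ⟨h1, _⟩ | ⟨h1, _⟩
    · rw [h1] at h
      have c := key (N - (a - b)) 2 (by linarith)
      omega
    · rw [h1] at h
      have c := key (N - (b - a)) 2 (by linarith)
      omega
end

section
/- Let ω be a real number with 0 ≤ ω < 1, let ε > 0 be a real number, let n be a positive integer, and set t = n + ⌈log₂(2 + 1/(2ε))⌉. For each integer x with 0 ≤ x < 2^t, define P(x) = |(1/2^t) · Σ_{j=0}^{2^t − 1} e^{2πi·j·(ω − x/2^t)}|². Then Σ_{x : d_t(x, ⌊2^t ω⌋) < 2^{t−n}} P(x) ≥ 1 − ε, where the sum ranges over all integers x with 0 ≤ x < 2^t satisfying d_t(x, ⌊2^t ω⌋) < 2^{t−n}. -/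
lemma aux_norm (θ : ℝ) (T : ℕ) (hs : Real.sin (Real.pi * θ) ≠ 0) :
    ‖∑ j ∈ Finset.range T, Complex.exp (2 * Real.pi * Complex.I * (j : ℂ) * (θ : ℂ))‖
      ≤ 1 / |Real.sin (Real.pi * θ)| := by
  set z : ℂ := Complex.exp (Complex.I * ((2 * Real.pi * θ : ℝ) : ℂ)) with hz
  have hz1 : ‖z - 1‖ = 2 * |Real.sin (Real.pi * θ)| := by
    rw [hz, Complex.norm_exp_I_mul_ofReal_sub_one, norm_mul, Real.norm_eq_abs, Real.norm_eq_abs]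
    rw [show 2 * Real.pi * θ / 2 = Real.pi * θ by ring]
    norm_num
  have hpos : 0 < |Real.sin (Real.pi * θ)| := abs_pos.mpr hs
  have hne : z ≠ 1 := by
    intro h
    rw [h] at hz1
    simp at hz1
    exact hs hz1
  have hzn : ‖z‖ = 1 := by
    rw [hz, mul_comm]; exact Complex.norm_exp_ofReal_mul_I _
  have hsum : ∑ j ∈ Finset.range T, Complex.exp (2 * Real.pi * Complex.I * (j : ℂ) * (θ : ℂ))
      = (z ^ T - 1) / (z - 1) := by
    rw [← geom_sum_eq hne]
    refine Finset.sum_congr rfl fun j _ => ?_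
    rw [hz, ← Complex.exp_nat_mul]
    congr 1
    push_cast
    ring
  rw [hsum, norm_div, hz1, div_le_div_iff₀ (by positivity) hpos]
  have : ‖z ^ T - 1‖ ≤ 2 := by
    calc ‖z ^ T - 1‖ ≤ ‖z ^ T‖ + ‖(1 : ℂ)‖ := norm_sub_le _ _
      _ = 2 := by rw [norm_pow, hzn]; norm_num
  nlinarith

lemma aux_sin (w : ℝ) (h0 : 0 < w) (h1 : w < 1) :
    0 < Real.sin (Real.pi * w) ∧
    1 / Real.sin (Real.pi * w) ^ 2 ≤ (1 / w ^ 2 + 1 / (1 - w) ^ 2) / 4 := by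
  have hpi := Real.pi_pos
  have hs : 0 < Real.sin (Real.pi * w) :=
    Real.sin_pos_of_pos_of_lt_pi (by positivity) (by nlinarith)
  refine ⟨hs, ?_⟩
  have h1w : 0 < 1 - w := by linarith
  rcases le_total w (1 / 2) with h | h
  · have h2 : 2 * w ≤ Real.sin (Real.pi * w) := by
      have := Real.mul_le_sin (x := Real.pi * w) (by positivity) (by nlinarith)
      rwa [show 2 / Real.pi * (Real.pi * w) = 2 * w by field_simp] at this
    calc 1 / Real.sin (Real.pi * w) ^ 2 ≤ 1 / (2 * w) ^ 2 := by gcongr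
      _ = (1 / w ^ 2 + 0) / 4 := by field_simp; norm_num
      _ ≤ _ := by gcongr; positivity
  · have h2 : 2 * (1 - w) ≤ Real.sin (Real.pi * w) := by
      have := Real.mul_le_sin (x := Real.pi * (1 - w)) (by positivity) (by nlinarith)
      rw [show 2 / Real.pi * (Real.pi * (1 - w)) = 2 * (1 - w) by field_simp] at this
      rwa [show Real.pi * (1 - w) = Real.pi - Real.pi * w by ring, Real.sin_pi_sub] at this
    calc 1 / Real.sin (Real.pi * w) ^ 2 ≤ 1 / (2 * (1 - w)) ^ 2 := by gcongr
      _ = (0 + 1 / (1 - w) ^ 2) / 4 := by field_simp; norm_num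
      _ ≤ _ := by gcongr; positivity

lemma aux_parseval (T : ℕ) (hT : 0 < T) (ω : ℝ) :
    ∑ x ∈ Finset.range T, ‖((1 / (T : ℂ)) * ∑ j ∈ Finset.range T,
        Complex.exp (2 * Real.pi * Complex.I * (j : ℂ) *
          ((ω : ℂ) - (x : ℂ) / (T : ℂ))) : ℂ)‖ ^ 2 = 1 := by
  have hTc : (T : ℂ) ≠ 0 := by exact_mod_cast hT.ne'
  have hprim := Complex.isPrimitiveRoot_exp T hT.ne'
  have key : ∀ j ∈ Finset.range T, ∀ k ∈ Finset.range T,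
      ∑ x ∈ Finset.range T, Complex.exp (2 * Real.pi * Complex.I * ((k : ℂ) - j) *
          ((x : ℂ) / (T : ℂ) - ω)) = if j = k then (T : ℂ) else 0 := by
    intro j hj k hk
    split_ifs with h
    · subst h; simp
    · set z : ℂ := Complex.exp (2 * Real.pi * Complex.I * ((((k : ℤ) - j : ℤ) : ℂ) / T)) with hz
      have hzT : z ^ T = 1 := by
        rw [hz, ← Complex.exp_nat_mul, Complex.exp_eq_one_iff]
        exact ⟨(k : ℤ) - j, by field_simp⟩
      have hz1 : z ≠ 1 := by
        intro h1
        rw [hz, Complex.exp_eq_one_iff] at h1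
        obtain ⟨q, hq⟩ := h1
        have hpi : (2 * Real.pi * Complex.I : ℂ) ≠ 0 := Complex.two_pi_I_ne_zero
        rw [mul_comm (q : ℂ)] at hq
        have hq := mul_left_cancel₀ hpi hq
        rw [div_eq_iff hTc] at hq
        have hq' : ((k : ℤ) - j : ℤ) = q * T := by exact_mod_cast hq
        rw [Finset.mem_range] at hj hk
        have hd : (T : ℤ) ∣ (k : ℤ) - j := ⟨q, by rw [hq']; ring⟩
        have := Int.eq_zero_of_abs_lt_dvd hd (by rw [abs_lt]; omega)
        omega
      have h2 : ∑ x ∈ Finset.range T, z ^ x = 0 := by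
        rw [geom_sum_eq hz1, hzT]; simp
      have h3 : ∀ x ∈ Finset.range T, Complex.exp (2 * Real.pi * Complex.I * ((k : ℂ) - j) *
          ((x : ℂ) / (T : ℂ) - ω)) =
          Complex.exp (-(2 * Real.pi * Complex.I * ((k : ℂ) - j) * ω)) * z ^ x := by
        intro x _
        rw [hz, ← Complex.exp_nat_mul, ← Complex.exp_add]
        congr 1
        push_cast
        ring
      rw [Finset.sum_congr rfl h3, ← Finset.mul_sum, h2, mul_zero]
  have hcast : ((∑ x ∈ Finset.range T, ‖((1 / (T : ℂ)) * ∑ j ∈ Finset.range T,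
        Complex.exp (2 * Real.pi * Complex.I * (j : ℂ) *
          ((ω : ℂ) - (x : ℂ) / (T : ℂ))) : ℂ)‖ ^ 2 : ℝ) : ℂ) = 1 := by
    push_cast
    have h4 : ∀ x ∈ Finset.range T, ((‖((1 / (T : ℂ)) * ∑ j ∈ Finset.range T,
        Complex.exp (2 * Real.pi * Complex.I * (j : ℂ) *
          ((ω : ℂ) - (x : ℂ) / (T : ℂ))) : ℂ)‖ : ℝ) : ℂ) ^ 2 =
        (1 / (T : ℂ) ^ 2) * ∑ j ∈ Finset.range T, ∑ k ∈ Finset.range T,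
          Complex.exp (2 * Real.pi * Complex.I * ((k : ℂ) - j) *
          ((x : ℂ) / (T : ℂ) - ω)) := by
      intro x _
      rw [← Complex.mul_conj', map_mul, map_sum]
      rw [mul_mul_mul_comm, Finset.sum_mul_sum]
      congr 1
      · simp; ring
      · refine Finset.sum_congr rfl fun j _ => Finset.sum_congr rfl fun k _ => ?_
        rw [← Complex.exp_conj, ← Complex.exp_add]
        congr 1
        have c2 : (starRingEnd ℂ) 2 = 2 := Complex.conj_ofNat 2
        simp [c2]
        ring
    rw [Finset.sum_congr rfl h4, ← Finset.mul_sum, Finset.sum_comm]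
    have h5 : ∀ j ∈ Finset.range T, ∑ x ∈ Finset.range T, ∑ k ∈ Finset.range T,
          Complex.exp (2 * Real.pi * Complex.I * ((k : ℂ) - j) *
          ((x : ℂ) / (T : ℂ) - ω)) = T := by
      intro j hj
      rw [Finset.sum_comm, Finset.sum_congr rfl (key j hj)]
      rw [Finset.sum_ite_eq, if_pos hj]
    rw [Finset.sum_congr rfl h5]
    simp
    field_simp
  exact_mod_cast hcast

lemma aux_tail (T k : ℕ) (hk : 3 ≤ k) (hkT : 2 * k ≤ T) :
    ∑ r ∈ Finset.Ico k (T - k + 1), (1 / ((r : ℝ) - 1) ^ 2 + 1 / ((T : ℝ) - r) ^ 2) / 4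
      ≤ 1 / (2 * ((k : ℝ) - 2)) := by
  set H : ℕ → ℝ := fun r => -(1 / ((r : ℝ) - 2)) + 1 / ((T : ℝ) - r) with hH
  have hstep : ∀ r ∈ Finset.Ico k (T - k + 1),
      (1 / ((r : ℝ) - 1) ^ 2 + 1 / ((T : ℝ) - r) ^ 2) / 4 ≤ (H (r + 1) - H r) / 4 := by
    intro r hr
    rw [Finset.mem_Ico] at hr
    have h1 : (3 : ℝ) ≤ r := by exact_mod_cast (by omega : 3 ≤ r)
    have h2 : (r : ℝ) + 3 ≤ T := by exact_mod_cast (by omega : r + 3 ≤ T)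
    have gen : ∀ a : ℝ, 1 < a → 1 / a ^ 2 ≤ 1 / (a - 1) - 1 / a := by
      intro a ha
      have : 0 < a - 1 := by linarith
      rw [div_sub_div _ _ (by positivity) (by positivity), div_le_div_iff₀ (by positivity) (by positivity)]
      nlinarith
    have g1 := gen (r - 1) (by linarith)
    have g2 := gen (T - r) (by linarith)
    simp only [hH]
    push_cast
    rw [show (r : ℝ) + 1 - 2 = r - 1 by ring, show (T : ℝ) - (r + 1) = T - r - 1 by ring]
    rw [show (r : ℝ) - 1 - 1 = r - 2 by ring] at g1
    linarith
  refine (Finset.sum_le_sum hstep).trans ?_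
  rw [← Finset.sum_div, Finset.sum_Ico_sub _ (by omega)]
  have hk' : (3 : ℝ) ≤ k := by exact_mod_cast hk
  have hT' : 2 * (k : ℝ) ≤ T := by exact_mod_cast hkT
  simp only [hH]
  push_cast [Nat.cast_sub (by omega : k ≤ T)]
  have e1 : 0 < 1 / ((T : ℝ) - k + 1 - 2) := by apply one_div_pos.mpr; linarith
  have e2 : 0 < 1 / ((T : ℝ) - k) := by apply one_div_pos.mpr; linarith
  have e3 : 1 / ((T : ℝ) - (T - k + 1)) ≤ 1 / ((k : ℝ) - 2) :=
    one_div_le_one_div_of_le (by linarith) (by linarith)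
  have e4 : 1 / (2 * ((k : ℝ) - 2)) = (1 / ((k : ℝ) - 2)) / 2 := by
    rw [div_div, mul_comm]
  rw [e4]
  linarith

lemma aux_P (T : ℕ) (ω : ℝ) (b : ℤ) (hb0 : (b : ℝ) ≤ T * ω) (hb1 : (T : ℝ) * ω < b + 1)
    (x r : ℕ) (q : ℤ) (hx : (x : ℤ) - b = r + q * T) (hr : 2 ≤ r) (hrT : r + 1 ≤ T) :
    ‖((1 / (T : ℂ)) * ∑ j ∈ Finset.range T,
        Complex.exp (2 * Real.pi * Complex.I * (j : ℂ) *
          ((ω : ℂ) - (x : ℂ) / (T : ℂ))) : ℂ)‖ ^ 2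
      ≤ (1 / ((r : ℝ) - 1) ^ 2 + 1 / ((T : ℝ) - r) ^ 2) / 4 := by
  have hT : (0 : ℝ) < T := by exact_mod_cast (by omega : 0 < T)
  have hr' : (2 : ℝ) ≤ r := by exact_mod_cast hr
  have hrT' : (r : ℝ) + 1 ≤ T := by exact_mod_cast hrT
  have hx' : (x : ℝ) - b = r + q * T := by exact_mod_cast hx
  set w : ℝ := (r - (T * ω - b)) / T with hw
  have hTw : T * w = r - (T * ω - b) := by rw [hw]; field_simp
  have hw0 : 0 < w := by rw [hw]; apply div_pos <;> linarith
  have hw1 : w < 1 := by rw [hw, div_lt_one hT]; linarith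
  obtain ⟨hs, hs2⟩ := aux_sin w hw0 hw1
  have hθ : ω - x / T = -w - q := by
    rw [hw]; field_simp; linarith
  have habs : |Real.sin (Real.pi * (ω - x / T))| = Real.sin (Real.pi * w) := by
    rw [hθ, show Real.pi * (-w - q) = -(Real.pi * w + q * Real.pi) by ring, Real.sin_neg, abs_neg,
      Real.sin_add_int_mul_pi, abs_mul, abs_of_pos hs]
    simp
  have hN := aux_norm (ω - x / T) T (by
    intro h; rw [h] at habs; simp at habs; linarith)
  rw [habs] at hN
  push_cast at hN
  rw [norm_mul, mul_pow]
  have hn1 : ‖(1 / (T : ℂ))‖ = 1 / T := by simp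
  rw [hn1]
  calc _ ≤ (1 / (T : ℝ)) ^ 2 * (1 / Real.sin (Real.pi * w)) ^ 2 := by gcongr
    _ = (1 / (T : ℝ)) ^ 2 * (1 / Real.sin (Real.pi * w) ^ 2) := by rw [div_pow 1 (Real.sin _)]; simp
    _ ≤ (1 / (T : ℝ)) ^ 2 * ((1 / w ^ 2 + 1 / (1 - w) ^ 2) / 4) := by gcongr
    _ = (1 / (T * w) ^ 2 + 1 / (T - T * w) ^ 2) / 4 := by
      rw [show (T : ℝ) - T * w = T * (1 - w) by ring]
      have : 1 - w ≠ 0 := by linarith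
      field_simp
    _ ≤ _ := by
      rw [hTw]
      have p1 : (0 : ℝ) < r - 1 := by linarith
      have p2 : (0 : ℝ) < T - r := by linarith
      gcongr <;> linarith

theorem stmt_3 (ω ε : ℝ) (hω0 : 0 ≤ ω) (hω1 : ω < 1) (hε : 0 < ε)
    (n : ℕ) (hn : 0 < n) (t : ℕ)
    (ht : (t : ℤ) = n + ⌈Real.logb 2 (2 + 1 / (2 * ε))⌉) :
    1 - ε ≤ ∑ x ∈ (Finset.range (2 ^ t)).filter
        (fun x : ℕ => dDist t (x : ℤ) ⌊(2 : ℝ) ^ t * ω⌋ < 2 ^ (t - n)),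
      ‖((1 / 2 ^ t) * ∑ j ∈ Finset.range (2 ^ t),
        Complex.exp (2 * Real.pi * Complex.I * (j : ℂ) *
          ((ω : ℂ) - (x : ℂ) / 2 ^ t)) : ℂ)‖ ^ 2 := by
  have hε2 : 0 < 1 / (2 * ε) := by positivity
  have hlog1 : 1 ≤ Real.logb 2 (2 + 1 / (2 * ε)) := by
    rw [Real.le_logb_iff_rpow_le (by norm_num) (by positivity)]
    simp; linarith
  have hc1 : 1 ≤ ⌈Real.logb 2 (2 + 1 / (2 * ε))⌉ := by
    have h := hlog1.trans (Int.le_ceil (Real.logb 2 (2 + 1 / (2 * ε))))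
    exact_mod_cast h
  have hnt : n ≤ t := by omega
  have hkε : 2 + 1 / (2 * ε) ≤ ((2 ^ (t - n) : ℕ) : ℝ) := by
    have h := Int.le_ceil (Real.logb 2 (2 + 1 / (2 * ε)))
    rw [show ⌈Real.logb 2 (2 + 1 / (2 * ε))⌉ = ((t - n : ℕ) : ℤ) by omega] at h
    rw [Real.logb_le_iff_le_rpow (by norm_num) (by positivity)] at h
    simpa using h
  have hkT : 2 * 2 ^ (t - n) ≤ 2 ^ t := by
    rw [← pow_succ']
    exact Nat.pow_le_pow_right (by norm_num) (by omega)
  have hcast : ((2 ^ t : ℕ) : ℂ) = 2 ^ t := by push_cast; rfl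
  have hcastR : ((2 ^ t : ℕ) : ℝ) = 2 ^ t := by push_cast; rfl
  have hcastZ : ((2 ^ t : ℕ) : ℤ) = 2 ^ t := by push_cast; rfl
  have hcastk : ((2 ^ (t - n) : ℕ) : ℤ) = 2 ^ (t - n) := by push_cast; rfl
  unfold dDist
  rw [← hcast, ← hcastR, ← hcastZ, ← hcastk]
  have hTpos : 0 < 2 ^ t := by positivity
  generalize 2 ^ t = T at *
  generalize 2 ^ (t - n) = k at *
  have hk3 : 3 ≤ k := by
    have : (2 : ℝ) < k := by linarith
    exact_mod_cast this
  have hTR : (0 : ℝ) < T := by exact_mod_cast hTpos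
  have hb0 := Int.floor_le ((T : ℝ) * ω)
  have hb1 := Int.lt_floor_add_one ((T : ℝ) * ω)
  have hbn : 0 ≤ ⌊(T : ℝ) * ω⌋ := Int.floor_nonneg.mpr (by positivity)
  have hbT : ⌊(T : ℝ) * ω⌋ < T := by
    rw [Int.floor_lt]; push_cast; nlinarith
  generalize ⌊(T : ℝ) * ω⌋ = b at *
  have hsum := aux_parseval T hTpos ω
  rw [← Finset.sum_filter_add_sum_filter_not _
    (fun x : ℕ => min |(x : ℤ) - b| ((T : ℤ) - |(x : ℤ) - b|) < (k : ℤ))] at hsum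
  have htail := aux_tail T k hk3 hkT
  have hbound : 1 / (2 * ((k : ℝ) - 2)) ≤ ε := by
    have h2 : 1 / (2 * ε) ≤ (k : ℝ) - 2 := by linarith
    have h3 : (0 : ℝ) < k - 2 := by linarith
    rw [div_le_iff₀ (by positivity)] at h2 ⊢
    linarith
  set B := (Finset.range T).filter
    (fun x : ℕ => ¬ min |(x : ℤ) - b| ((T : ℤ) - |(x : ℤ) - b|) < (k : ℤ)) with hB
  set R : ℕ → ℕ := fun x => (if b ≤ x then (x : ℤ) - b else (x : ℤ) - b + T).toNat with hR
  have hmem : ∀ x ∈ B, (x : ℤ) < T ∧ (k : ℤ) ≤ R x ∧ (R x : ℤ) ≤ T - k ∧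
      ((b ≤ x ∧ (x : ℤ) - b = R x) ∨ ((x : ℤ) < b ∧ (x : ℤ) - b = R x - T)) := by
    intro x hx
    rw [hB, Finset.mem_filter, Finset.mem_range] at hx
    obtain ⟨h1, h2⟩ := hx
    rw [not_lt, le_min_iff] at h2
    simp only [hR]
    rcases le_or_gt b x with h | h
    · rw [abs_of_nonneg (by omega)] at h2
      rw [if_pos h]
      omega
    · rw [abs_of_neg (by omega)] at h2
      rw [if_neg (by omega)]
      omega
  have hbad : ∑ x ∈ B, ‖((1 / (T : ℂ)) * ∑ j ∈ Finset.range T,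
        Complex.exp (2 * Real.pi * Complex.I * (j : ℂ) *
          ((ω : ℂ) - (x : ℂ) / (T : ℂ))) : ℂ)‖ ^ 2 ≤ ε := by
    calc _ ≤ ∑ x ∈ B, (1 / ((R x : ℝ) - 1) ^ 2 + 1 / ((T : ℝ) - R x) ^ 2) / 4 := by
          refine Finset.sum_le_sum fun x hx => ?_
          obtain ⟨h1, h2, h3, h4⟩ := hmem x hx
          rcases h4 with h4 | h4
          · exact aux_P T ω b hb0 hb1 x (R x) 0 (by omega) (by omega) (by omega)
          · exact aux_P T ω b hb0 hb1 x (R x) (-1) (by omega) (by omega) (by omega)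
      _ = ∑ r ∈ B.image R, (1 / ((r : ℝ) - 1) ^ 2 + 1 / ((T : ℝ) - r) ^ 2) / 4 := by
          rw [Finset.sum_image]
          intro x hx y hy hxy
          have h1 := hmem x hx
          have h2 := hmem y hy
          rw [hxy] at h1
          omega
      _ ≤ ∑ r ∈ Finset.Ico k (T - k + 1),
            (1 / ((r : ℝ) - 1) ^ 2 + 1 / ((T : ℝ) - r) ^ 2) / 4 := by
          apply Finset.sum_le_sum_of_subset_of_nonneg
          · intro r hr
            rw [Finset.mem_image] at hr
            obtain ⟨x, hx, rfl⟩ := hr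
            have := hmem x hx
            rw [Finset.mem_Ico]
            omega
          · intros; positivity
      _ ≤ ε := htail.trans hbound
  linarith
end

section
/- Let ω be a real number with 0 ≤ ω < 1, let ε > 0 be a real number, let n be a positive integer, and set t = n + ⌈log₂(2 + 1/(2ε))⌉. For each integer x with 0 ≤ x < 2^t, define P(x) = |(1/2^t) · Σ_{j=0}^{2^t − 1} e^{2πi·j·(ω − x/2^t)}|². Then Σ_{x : d_n(⌊x / 2^{t−n}⌋, ⌊2^n ω⌋) ≤ 1} P(x) ≥ 1 − ε, where the sum ranges over all integers x with 0 ≤ x < 2^t such that the integer formed by the first n bits of x is within d_n-distance 1 of ⌊2^n ω⌋. -/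
/-- The phase estimation amplitude. -/
noncomputable def qpeAmp (N : ℕ) (ω : ℝ) (x : ℕ) : ℂ :=
  ∑ j ∈ Finset.range N, Complex.exp (2 * Real.pi * Complex.I * (j : ℂ) * ((ω : ℂ) - (x : ℂ) / N))

lemma qpe_orth (N : ℕ) (hN : 0 < N) (j k : ℕ) (hj : j < N) (hk : k < N) (hjk : j ≠ k) :
    ∑ x ∈ Finset.range N, (Complex.exp (2 * Real.pi * Complex.I * (((k : ℂ) - j) / N))) ^ x = 0 := by
  have hN' : (N : ℂ) ≠ 0 := by exact_mod_cast hN.ne'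
  have h2 : (2 * Real.pi * Complex.I : ℂ) ≠ 0 := Complex.two_pi_I_ne_zero
  set r := Complex.exp (2 * Real.pi * Complex.I * (((k : ℂ) - j) / N)) with hr
  have hr1 : r ≠ 1 := by
    intro h
    rw [hr, Complex.exp_eq_one_iff] at h
    obtain ⟨m, hm⟩ := h
    rw [mul_comm (m : ℂ)] at hm
    have h3 := mul_left_cancel₀ h2 hm
    rw [div_eq_iff hN'] at h3
    have h4 : (k : ℤ) - j = m * N := by exact_mod_cast h3
    rcases lt_trichotomy m 0 with h | h | h
    · nlinarith
    · subst h; omega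
    · nlinarith
  have hrN : r ^ N = 1 := by
    rw [hr, ← Complex.exp_nat_mul, Complex.exp_eq_one_iff]
    refine ⟨(k : ℤ) - j, ?_⟩
    push_cast
    field_simp
  rw [geom_sum_eq hr1, hrN]; simp

lemma qpe_parseval (N : ℕ) (hN : 0 < N) (ω : ℝ) :
    ∑ x ∈ Finset.range N, ‖qpeAmp N ω x‖ ^ 2 = (N : ℝ) ^ 2 := by
  have key : ∀ x : ℕ, ((‖qpeAmp N ω x‖ ^ 2 : ℝ) : ℂ) =
      ∑ j ∈ Finset.range N, ∑ k ∈ Finset.range N,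
        Complex.exp (2 * Real.pi * Complex.I * ((j : ℂ) - k) * ω) *
        (Complex.exp (2 * Real.pi * Complex.I * (((k : ℂ) - j) / N))) ^ x := by
    intro x
    have := Complex.mul_conj' (qpeAmp N ω x)
    push_cast
    rw [← this, qpeAmp, map_sum, Finset.sum_mul_sum]
    refine Finset.sum_congr rfl fun j _ => Finset.sum_congr rfl fun k _ => ?_
    rw [← Complex.exp_conj, ← Complex.exp_add, ← Complex.exp_nat_mul, ← Complex.exp_add]
    congr 1
    have h2 : (starRingEnd ℂ) 2 = 2 := Complex.conj_ofNat 2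
    simp [h2]
    ring
  have : ((∑ x ∈ Finset.range N, ‖qpeAmp N ω x‖ ^ 2 : ℝ) : ℂ) = ((N : ℝ) ^ 2 : ℝ) := by
    rw [Complex.ofReal_sum, Finset.sum_congr rfl (fun x _ => key x), Finset.sum_comm]
    have : ∀ j ∈ Finset.range N, ∑ x ∈ Finset.range N, ∑ k ∈ Finset.range N,
        Complex.exp (2 * Real.pi * Complex.I * ((j : ℂ) - k) * ω) *
        (Complex.exp (2 * Real.pi * Complex.I * (((k : ℂ) - j) / N))) ^ x = N := by
      intro j hj
      rw [Finset.sum_comm, Finset.sum_eq_single_of_mem j hj]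
      · simp
      · intro k hk hkj
        rw [← Finset.mul_sum, qpe_orth N hN j k (Finset.mem_range.1 hj) (Finset.mem_range.1 hk)
          (Ne.symm hkj), mul_zero]
    rw [Finset.sum_congr rfl this]
    simp [sq]
  exact_mod_cast this

lemma qpe_sin (u : ℝ) (h0 : 0 < u) (h1 : u < 1) :
    1 / Real.sin (Real.pi * u) ^ 2 ≤ (1 / u ^ 2 + 1 / (1 - u) ^ 2) / 4 := by
  have base : ∀ v : ℝ, 0 < v → v ≤ 1 / 2 → 1 / Real.sin (Real.pi * v) ^ 2 ≤ (1 / v ^ 2) / 4 := by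
    intro v hv hv'
    have hp := Real.pi_pos
    have h := Real.mul_le_sin (x := Real.pi * v) (by positivity) (by nlinarith)
    have e : 2 / Real.pi * (Real.pi * v) = 2 * v := by field_simp
    rw [e] at h
    have : (1 / v ^ 2) / 4 = 1 / (2 * v) ^ 2 := by field_simp; norm_num
    rw [this]
    gcongr
  have hu : 0 < 1 - u := by linarith
  have a1 : 0 < 1 / u ^ 2 := by positivity
  have a2 : 0 < 1 / (1 - u) ^ 2 := by positivity
  rcases le_total u (1 / 2) with h | h
  · linarith [base u h0 h]
  · have := base (1 - u) hu (by linarith)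
    have e : Real.sin (Real.pi * (1 - u)) = Real.sin (Real.pi * u) := by
      rw [mul_sub, mul_one, Real.sin_pi_sub]
    rw [e] at this
    linarith

/-- Pointwise bound. -/
lemma qpe_bound (N : ℕ) (hN : 0 < N) (ω : ℝ) (x : ℕ) (s : ℝ) (m : ℤ) (h0 : 0 < s) (h1 : s < N)
    (hs : s = x - N * ω + m * N) :
    ‖qpeAmp N ω x‖ ^ 2 ≤ (N : ℝ) ^ 2 * ((1 / s ^ 2 + 1 / (N - s) ^ 2) / 4) := by
  have hN' : (0 : ℝ) < N := by exact_mod_cast hN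
  have hNc : (N : ℂ) ≠ 0 := by exact_mod_cast hN.ne'
  set θ : ℝ := ω - x / N with hθ
  set z : ℂ := Complex.exp ((2 * Real.pi * θ : ℝ) * Complex.I) with hz
  have hA : qpeAmp N ω x = ∑ j ∈ Finset.range N, z ^ j := by
    rw [qpeAmp]
    refine Finset.sum_congr rfl fun j _ => ?_
    rw [hz, ← Complex.exp_nat_mul, hθ]
    congr 1
    push_cast
    ring
  have hznorm : ‖z‖ = 1 := Complex.norm_exp_ofReal_mul_I _
  have hmul : ‖qpeAmp N ω x‖ * ‖z - 1‖ ≤ 2 := by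
    rw [hA, ← norm_mul, geom_sum_mul]
    calc ‖z ^ N - 1‖ ≤ ‖z ^ N‖ + ‖(1 : ℂ)‖ := norm_sub_le _ _
      _ = 2 := by rw [norm_pow, hznorm]; norm_num
  have hz1 : ‖z - 1‖ ^ 2 = 4 * Real.sin (Real.pi * θ) ^ 2 := by
    have : ‖z - 1‖ = ‖2 * Real.sin (2 * Real.pi * θ / 2)‖ := by
      rw [hz, mul_comm, Complex.norm_exp_I_mul_ofReal_sub_one]
    rw [this, Real.norm_eq_abs, sq_abs]
    rw [show 2 * Real.pi * θ / 2 = Real.pi * θ by ring]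
    ring
  have hu : s / N = -θ + m := by rw [hs, hθ]; field_simp; ring
  have hsin : Real.sin (Real.pi * (s / N)) ^ 2 = Real.sin (Real.pi * θ) ^ 2 := by
    rw [hu, show Real.pi * (-θ + m) = -(Real.pi * θ) + m * Real.pi by ring,
      Real.sin_add_int_mul_pi, Real.sin_neg, mul_pow, neg_sq, ← zpow_natCast, ← zpow_mul, mul_comm m,
      zpow_mul]
    simp
  have hu0 : 0 < s / N := by positivity
  have hu1 : s / N < 1 := (div_lt_one hN').2 h1
  have hspos : 0 < Real.sin (Real.pi * (s / N)) :=
    Real.sin_pos_of_pos_of_lt_pi (by positivity) (by nlinarith [Real.pi_pos])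
  have h3 := qpe_sin _ hu0 hu1
  have e : (1 / (s / N) ^ 2 + 1 / (1 - s / N) ^ 2) / 4 =
      (N : ℝ) ^ 2 * ((1 / s ^ 2 + 1 / (N - s) ^ 2) / 4) := by
    have : (N : ℝ) - s ≠ 0 := by linarith
    have : 1 - s / N = (N - s) / N := by field_simp
    rw [this]
    field_simp
  rw [← e]
  refine le_trans ?_ h3
  rw [le_div_iff₀ (by positivity), hsin]
  have : (‖qpeAmp N ω x‖ * ‖z - 1‖) ^ 2 ≤ 2 ^ 2 := by gcongr
  rw [mul_pow, hz1] at this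
  linarith

lemma qpe_tele (N M : ℕ) (hM : 3 ≤ M) :
    ∑ k ∈ Finset.Ico (M + 1) (N - M), (1 / ((k : ℝ) - 1) ^ 2 + 1 / ((N : ℝ) - k) ^ 2) ≤
      2 / ((M : ℝ) - 1) := by
  have hM' : (3 : ℝ) ≤ M := by exact_mod_cast hM
  rcases le_or_gt (N - M) (M + 1) with h | h
  · rw [Finset.Ico_eq_empty (by omega), Finset.sum_empty]
    apply div_nonneg <;> linarith
  have hNM : (M : ℝ) + 1 + 1 + M ≤ N := by exact_mod_cast (by omega : M + 1 + 1 + M ≤ N)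
  let G : ℕ → ℝ := fun k => -(1 / ((k : ℝ) - 2)) + 1 / ((N : ℝ) - k)
  have h1 : ∀ k ∈ Finset.Ico (M + 1) (N - M),
      (1 / ((k : ℝ) - 1) ^ 2 + 1 / ((N : ℝ) - k) ^ 2) ≤ G (k + 1) - G k := by
    intro k hk
    rw [Finset.mem_Ico] at hk
    have k1 : (M : ℝ) + 1 ≤ k := by exact_mod_cast hk.1
    have k2 : (k : ℝ) + 1 + M ≤ N := by exact_mod_cast (by omega : k + 1 + M ≤ N)
    have aux : ∀ y : ℝ, 1 < y → 1 / y ^ 2 ≤ 1 / (y - 1) - 1 / y := by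
      intro y hy
      have : 0 < y - 1 := by linarith
      have e : 1 / (y - 1) - 1 / y = 1 / ((y - 1) * y) := by field_simp; ring
      rw [e]
      apply one_div_le_one_div_of_le
      · positivity
      · nlinarith
    have a1 := aux ((k : ℝ) - 1) (by linarith)
    have a2 := aux ((N : ℝ) - k) (by linarith)
    simp only [G]
    push_cast
    rw [show (k : ℝ) + 1 - 2 = k - 1 by ring, show (N : ℝ) - (k + 1) = N - k - 1 by ring]
    rw [show (k : ℝ) - 1 - 1 = k - 2 by ring] at a1
    linarith
  refine (Finset.sum_le_sum h1).trans ?_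
  rw [Finset.sum_Ico_sub G h.le]
  simp only [G]
  rw [Nat.cast_sub (by omega : M ≤ N)]
  push_cast
  have p1 : 0 ≤ 1 / ((N : ℝ) - M - 2) := by apply div_nonneg <;> linarith
  have p2 : 0 ≤ 1 / ((N : ℝ) - (M + 1)) := by apply div_nonneg <;> linarith
  have p3 : 1 / (M : ℝ) ≤ 1 / (M - 1) := by
    apply one_div_le_one_div_of_le <;> linarith
  rw [show (N : ℝ) - (N - M) = M by ring, show (M : ℝ) + 1 - 2 = M - 1 by ring]
  have : 2 / ((M : ℝ) - 1) = 1 / (M - 1) + 1 / (M - 1) := by ring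
  linarith

/-- Index arithmetic. -/
lemma qpe_index (n p : ℕ) (b x : ℕ) (hb : b < 2 ^ n * 2 ^ p) (hx : x < 2 ^ n * 2 ^ p)
    (h : ¬ dDist n ((x : ℤ) / 2 ^ p) ((b : ℤ) / 2 ^ p) ≤ 1) :
    (b < x ∧ 2 ^ p + 1 ≤ x - b ∧ x - b < 2 ^ n * 2 ^ p - 2 ^ p) ∨
    (x < b ∧ 2 ^ p + 1 ≤ x + 2 ^ n * 2 ^ p - b ∧
      x + 2 ^ n * 2 ^ p - b < 2 ^ n * 2 ^ p - 2 ^ p) := by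
  have hM : 0 < 2 ^ p := by positivity
  have hK : 0 < 2 ^ n := by positivity
  unfold dDist at h
  rw [not_le, lt_min_iff] at h
  have e : (2 : ℤ) ^ p = ((2 ^ p : ℕ) : ℤ) := by push_cast; rfl
  have e' : (2 : ℤ) ^ n = ((2 ^ n : ℕ) : ℤ) := by push_cast; rfl
  rw [e, e'] at h
  generalize 2 ^ p = M at *
  generalize 2 ^ n = K at *
  obtain ⟨h1, h2⟩ := h
  have hMz : (0 : ℤ) < M := by exact_mod_cast hM
  have x1 := Int.mul_ediv_add_emod (x : ℤ) M
  have x2 := Int.emod_nonneg (x : ℤ) hMz.ne'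
  have x3 := Int.emod_lt_of_pos (x : ℤ) hMz
  have b1 := Int.mul_ediv_add_emod (b : ℤ) M
  have b2 := Int.emod_nonneg (b : ℤ) hMz.ne'
  have b3 := Int.emod_lt_of_pos (b : ℤ) hMz
  set q := (x : ℤ) / M
  set c := (b : ℤ) / M
  have hle : M ≤ K * M := Nat.le_mul_of_pos_left M hK
  have hcast : ((K * M : ℕ) : ℤ) = K * M := by push_cast; rfl
  rcases abs_cases (q - c) with ⟨ha, hs⟩ | ⟨ha, hs⟩
  · left
    rw [ha] at h1 h2
    have y1 : (M : ℤ) * (c + 2) ≤ M * q := mul_le_mul_of_nonneg_left (by linarith) hMz.le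
    have y2 : (M : ℤ) * q ≤ M * (K + c - 2) := mul_le_mul_of_nonneg_left (by linarith) hMz.le
    have z1 : (b : ℤ) + M < x := by linarith
    have z2 : (x : ℤ) + M < b + (K * M : ℕ) := by rw [hcast]; linarith
    omega
  · right
    rw [ha] at h1 h2
    have y1 : (M : ℤ) * q ≤ M * (c - 2) := mul_le_mul_of_nonneg_left (by linarith) hMz.le
    have y2 : (M : ℤ) * (c + 2 - K) ≤ M * q := mul_le_mul_of_nonneg_left (by linarith) hMz.le
    have z1 : (x : ℤ) + M < b := by linarith
    have z2 : (b : ℤ) + M < x + (K * M : ℕ) := by rw [hcast]; linarith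
    omega

theorem stmt_4 (ω ε : ℝ) (hω0 : 0 ≤ ω) (hω1 : ω < 1) (hε : 0 < ε)
    (n : ℕ) (hn : 0 < n) (t : ℕ)
    (ht : (t : ℤ) = n + ⌈Real.logb 2 (2 + 1 / (2 * ε))⌉) :
    1 - ε ≤ ∑ x ∈ (Finset.range (2 ^ t)).filter
        (fun x : ℕ => dDist n ((x : ℤ) / 2 ^ (t - n)) ⌊(2 : ℝ) ^ n * ω⌋ ≤ 1),
      ‖((1 / 2 ^ t) * ∑ j ∈ Finset.range (2 ^ t),
        Complex.exp (2 * Real.pi * Complex.I * (j : ℂ) *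
          ((ω : ℂ) - (x : ℂ) / 2 ^ t)) : ℂ)‖ ^ 2 := by
  have hL : (2 : ℝ) < 2 + 1 / (2 * ε) := by
    have : 0 < 1 / (2 * ε) := by positivity
    linarith
  have hlog : 1 < Real.logb 2 (2 + 1 / (2 * ε)) := by
    rw [Real.lt_logb_iff_rpow_lt (by norm_num) (by linarith)]
    simpa using hL
  have hc : 1 < ⌈Real.logb 2 (2 + 1 / (2 * ε))⌉ := by
    rw [Int.lt_ceil]; exact_mod_cast hlog
  obtain ⟨p, rfl⟩ : ∃ p, t = n + p := ⟨t - n, by omega⟩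
  have hp : (p : ℤ) = ⌈Real.logb 2 (2 + 1 / (2 * ε))⌉ := by push_cast at ht; linarith
  have hp2 : 2 ≤ p := by omega
  have hMge : 2 + 1 / (2 * ε) ≤ ((2 ^ p : ℕ) : ℝ) := by
    have h1 : Real.logb 2 (2 + 1 / (2 * ε)) ≤ (p : ℝ) := by
      have := Int.le_ceil (Real.logb 2 (2 + 1 / (2 * ε)))
      rw [← hp] at this
      exact_mod_cast this
    rw [Real.logb_le_iff_le_rpow (by norm_num) (by linarith)] at h1
    push_cast
    rwa [Real.rpow_natCast] at h1
  have hM3 : 3 ≤ 2 ^ p := by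
    have : 2 ^ 2 ≤ 2 ^ p := Nat.pow_le_pow_right (by norm_num) hp2
    omega
  rw [Nat.add_sub_cancel_left]
  set N : ℕ := 2 ^ (n + p) with hNdef
  have hNmul : N = 2 ^ n * 2 ^ p := by rw [hNdef, pow_add]
  have hN : 0 < N := by positivity
  have hNr : (0 : ℝ) < N := by exact_mod_cast hN
  have hterm : ∀ x : ℕ, ‖((1 / 2 ^ (n + p)) * ∑ j ∈ Finset.range N,
        Complex.exp (2 * Real.pi * Complex.I * (j : ℂ) *
          ((ω : ℂ) - (x : ℂ) / 2 ^ (n + p))) : ℂ)‖ ^ 2 = ‖qpeAmp N ω x‖ ^ 2 / (N : ℝ) ^ 2 := by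
    intro x
    have e : (2 : ℂ) ^ (n + p) = (N : ℂ) := by rw [hNdef]; push_cast; rfl
    rw [e, norm_mul, mul_pow, qpeAmp]
    simp
    ring
  rw [Finset.sum_congr rfl (fun x _ => hterm x)]
  -- integer part
  set b : ℕ := ⌊(N : ℝ) * ω⌋₊ with hb
  have hb0 : (b : ℝ) ≤ N * ω := Nat.floor_le (by positivity)
  have hb1 : (N : ℝ) * ω < b + 1 := Nat.lt_floor_add_one _
  have hbN : b < N := by
    have : (b : ℝ) < N := by nlinarith
    exact_mod_cast this
  have hfl : ⌊(2 : ℝ) ^ n * ω⌋ = (b : ℤ) / 2 ^ p := by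
    have e : (2 : ℝ) ^ n * ω = (N * ω) / ((2 ^ p : ℕ) : ℝ) := by
      rw [hNmul]; push_cast; field_simp
    have e2 : (b : ℤ) = ⌊(N : ℝ) * ω⌋ := Int.natCast_floor_eq_floor (by positivity)
    rw [e, e2, Int.floor_div_natCast]
    push_cast; rfl
  rw [hfl]
  set good : ℕ → Prop := fun x => dDist n ((x : ℤ) / 2 ^ p) ((b : ℤ) / 2 ^ p) ≤ 1 with hgood
  have htot := qpe_parseval N hN ω
  have hsplit := Finset.sum_filter_add_sum_filter_not (Finset.range N) good
    (fun x => ‖qpeAmp N ω x‖ ^ 2 / (N : ℝ) ^ 2)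
  rw [← Finset.sum_div (Finset.range N), htot, div_self (by positivity)] at hsplit
  let F : ℕ → ℝ := fun k =>
    (1 / ((k : ℝ) - 1) ^ 2 + 1 / ((N : ℝ) - k) ^ 2) / 4
  let κ : ℕ → ℕ := fun x => if b < x then x - b else x + N - b
  have hbad : ∑ x ∈ (Finset.range N).filter (fun x => ¬ good x),
      ‖qpeAmp N ω x‖ ^ 2 / (N : ℝ) ^ 2 ≤ ∑ k ∈ Finset.Ico (2 ^ p + 1) (N - 2 ^ p), F k := by
    have hidx : ∀ x ∈ (Finset.range N).filter (fun x => ¬ good x),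
        (b < x ∧ 2 ^ p + 1 ≤ x - b ∧ x - b < N - 2 ^ p) ∨
        (x < b ∧ 2 ^ p + 1 ≤ x + N - b ∧ x + N - b < N - 2 ^ p) := by
      intro x hx
      rw [Finset.mem_filter, Finset.mem_range] at hx
      have := qpe_index n p b x (hNmul ▸ hbN) (hNmul ▸ hx.1) hx.2
      rwa [← hNmul] at this
    have hinj : Set.InjOn κ ((Finset.range N).filter (fun x => ¬ good x) : Finset ℕ) := by
      intro x hx y hy hxy
      have hx' := Finset.mem_range.1 (Finset.mem_filter.1 (Finset.mem_coe.1 hx)).1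
      have hy' := Finset.mem_range.1 (Finset.mem_filter.1 (Finset.mem_coe.1 hy)).1
      simp only [κ] at hxy
      split_ifs at hxy <;> omega
    have hFnn : ∀ k, 0 ≤ F k := fun k => by simp only [F]; positivity
    calc _ ≤ ∑ x ∈ (Finset.range N).filter (fun x => ¬ good x), F (κ x) := by
          refine Finset.sum_le_sum fun x hx => ?_
          have hk : ∃ m : ℤ, ((κ x : ℕ) : ℝ) = x - b + m * N ∧ 2 ^ p + 1 ≤ κ x ∧ κ x < N - 2 ^ p := by
            rcases hidx x hx with ⟨h1, h2, h3⟩ | ⟨h1, h2, h3⟩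
            · refine ⟨0, ?_, ?_⟩
              · simp only [κ, if_pos h1]; rw [Nat.cast_sub h1.le]; simp
              · simp only [κ, if_pos h1]; exact ⟨h2, h3⟩
            · refine ⟨1, ?_, ?_⟩
              · simp only [κ, if_neg h1.not_gt]; rw [Nat.cast_sub (by omega)]; push_cast; ring
              · simp only [κ, if_neg h1.not_gt]; exact ⟨h2, h3⟩
          obtain ⟨m, hm, k1, k2⟩ := hk
          have k1' : (4 : ℝ) ≤ κ x := by exact_mod_cast (by omega : 4 ≤ κ x)
          have k2' : (κ x : ℝ) + 1 ≤ N := by exact_mod_cast (by omega : κ x + 1 ≤ N)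
          have hs := qpe_bound N hN ω x (x - N * ω + m * N) m (by linarith) (by linarith) rfl
          set s : ℝ := x - N * ω + m * N
          rw [div_le_iff₀ (by positivity), mul_comm]
          refine hs.trans ?_
          simp only [F]
          have q1 : 0 < (κ x : ℝ) - 1 := by linarith
          have q2 : 0 < (N : ℝ) - κ x := by linarith
          have q3 : (κ x : ℝ) - 1 ≤ s := by simp only [s]; linarith
          have q4 : (N : ℝ) - κ x ≤ N - s := by simp only [s]; linarith
          gcongr
      _ = ∑ k ∈ ((Finset.range N).filter (fun x => ¬ good x)).image κ, F k :=
          (Finset.sum_image hinj).symm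
      _ ≤ _ := by
          refine Finset.sum_le_sum_of_subset_of_nonneg ?_ fun k _ _ => hFnn k
          intro k hk
          obtain ⟨x, hx, rfl⟩ := Finset.mem_image.1 hk
          rw [Finset.mem_Ico]
          rcases hidx x hx with ⟨h1, h2, h3⟩ | ⟨h1, h2, h3⟩
          · simp only [κ, if_pos h1]; exact ⟨h2, h3⟩
          · simp only [κ, if_neg h1.not_gt]; exact ⟨h2, h3⟩
  have htele := qpe_tele N (2 ^ p) hM3
  simp only [F] at hbad
  rw [← Finset.sum_div (Finset.Ico (2 ^ p + 1) (N - 2 ^ p))] at hbad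
  have hfin : 2 / (((2 ^ p : ℕ) : ℝ) - 1) / 4 ≤ ε := by
    have h1 : 1 / (2 * ε) ≤ ((2 ^ p : ℕ) : ℝ) - 1 := by linarith
    have h0 : 0 < 1 / (2 * ε) := by positivity
    have h2 : 0 < ((2 ^ p : ℕ) : ℝ) - 1 := by linarith
    rw [div_le_iff₀ (by positivity)] at h1
    rw [div_div, div_le_iff₀ (by positivity)]
    linarith
  change 1 - ε ≤ ∑ x ∈ (Finset.range N).filter good, ‖qpeAmp N ω x‖ ^ 2 / (N : ℝ) ^ 2
  linarith
end

section
/- Let t > 2 be a positive integer and let x, y be integers with 0 ≤ x, y < 2^t such that d_t(x, y) ≤ 1. Then for every b ∈ {−1, 0, 1}, one has (x + b) mod 2^t = y if and only if ((x mod 4) + b) mod 4 = y mod 4. -/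
theorem stmt_6 (t : ℕ) (ht : 2 < t) (x y : ℤ)
    (hx : 0 ≤ x) (hx' : x < 2 ^ t) (hy : 0 ≤ y) (hy' : y < 2 ^ t)
    (hd : dDist t x y ≤ 1) :
    ∀ b ∈ ({-1, 0, 1} : Set ℤ),
      ((x + b) % 2 ^ t = y ↔ (x % 4 + b) % 4 = y % 4) := by
  intro b hb
  have hb' : b = -1 ∨ b = 0 ∨ b = 1 := by simpa using hb
  obtain ⟨k, rfl⟩ : ∃ k, t = 3 + k := ⟨t - 3, by omega⟩
  have hk : (0 : ℤ) < 2 ^ k := by positivity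
  have hN : (2 : ℤ) ^ (3 + k) = 8 * 2 ^ k := by rw [pow_add]; norm_num
  unfold dDist at hd
  rw [hN] at hx' hy' hd ⊢
  clear hN
  generalize (2 : ℤ) ^ k = m at hk hx' hy' hd ⊢
  have hmod : (x + b) % (8 * m) =
      if x + b < 0 then x + b + 8 * m else if x + b < 8 * m then x + b else x + b - 8 * m := by
    split_ifs with h1 h2
    · rw [← Int.add_emod_right, Int.emod_eq_of_lt (by omega) (by omega)]
    · rw [Int.emod_eq_of_lt (by omega) (by omega)]
    · rw [← Int.sub_emod_right, Int.emod_eq_of_lt (by omega) (by omega)]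
  rw [hmod]
  rcases abs_cases (x - y) with ⟨h, _⟩ | ⟨h, _⟩ <;> rw [h] at hd <;>
    rcases min_le_iff.mp hd with hd | hd <;> rcases hb' with rfl | rfl | rfl <;>
    split_ifs <;> omega
end

section
/- Let t ≥ 2 and p ≥ 0 be integers with p ≤ t − 2, and let w, m be integers with 0 ≤ w, m < 2^t such that 2^p ≤ w mod 2^{t−2} ≤ 2^{t−2} − 2^p. If d_t(m, w) < 2^p, then |m − w| = d_t(m, w) < 2^p and ⌊m / 2^{t−2}⌋ = ⌊w / 2^{t−2}⌋ (the first two bits of m and w agree). -/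
theorem stmt_9 (t p : ℕ) (ht : 2 ≤ t) (hp : p ≤ t - 2)
    (w m : ℤ) (hw0 : 0 ≤ w) (hw : w < 2 ^ t) (hm0 : 0 ≤ m) (hm : m < 2 ^ t)
    (hlo : 2 ^ p ≤ w % 2 ^ (t - 2)) (hhi : w % 2 ^ (t - 2) ≤ 2 ^ (t - 2) - 2 ^ p)
    (hd : dDist t m w < 2 ^ p) :
    |m - w| = dDist t m w ∧ |m - w| < 2 ^ p ∧
    m / 2 ^ (t - 2) = w / 2 ^ (t - 2) := by
  have hT : (2:ℤ) ^ t = 4 * 2 ^ (t - 2) := by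
    obtain ⟨k, rfl⟩ := Nat.exists_eq_add_of_le ht
    rw [Nat.add_sub_cancel_left, pow_add]; norm_num
  have hP : (0:ℤ) < 2 ^ p := by positivity
  have hQ : (0:ℤ) < 2 ^ (t - 2) := by positivity
  have hdiv := Int.mul_ediv_add_emod w (2 ^ (t - 2))
  unfold dDist at *
  rw [hT] at hw hm hd ⊢
  generalize (2:ℤ) ^ p = P at *
  generalize (2:ℤ) ^ (t - 2) = Q at *
  have hq0 : 0 ≤ w / Q := Int.ediv_nonneg hw0 hQ.le
  have hq3 : w / Q < 4 := Int.ediv_lt_of_lt_mul hQ hw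
  generalize w % Q = r at *
  generalize w / Q = q at *
  have h1 : 0 ≤ Q * q := mul_nonneg hQ.le hq0
  have h2 : Q * q ≤ 3 * Q := by nlinarith
  have habs : |m - w| < P := by
    rcases min_lt_iff.1 hd with h | h
    · exact h
    · rcases abs_cases (m - w) with ⟨h3, _⟩ | ⟨h3, _⟩ <;> rw [h3] at h <;> linarith
  refine ⟨?_, habs, ?_⟩
  · rw [min_eq_left]
    linarith
  · rw [abs_lt] at habs
    have := Int.ediv_emod_unique (a := m) (r := m - Q * q) (q := q) hQ
    exact (this.2 ⟨by ring, by linarith, by linarith⟩).1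
end
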